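/- Let S be a gambling strategy. Then for all n, all y ∈ O^{n−1}, all μ̄ ∈ P(O^ω)^n, and all x ∈ yO^ω: SV (PG S)_n(y,μ̄)(x) − SVmin (PG S)_n(y,μ̄) ≤ 2·max_{m<n} sup_{y'∈O^m} ‖S_m(y')‖ + 1, where ‖·‖ is the sup norm on Gm(O^ω). In particular, the left-hand side is uniformly bounded. -/

import Mathlib

open MeasureTheory Filter Set Topology
open scoped NNReal ENNReal

noncomputable section

/-- The completion of the ambient σ-algebra with respect to a measure `μ`:
the σ-algebra of `μ`-null-measurable sets. -/
def completionMS {Y : Type*} [MeasurableSpace Y] (μ : Measure Y) : MeasurableSpace Y where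
  MeasurableSet' s := NullMeasurableSet s μ
  measurableSet_empty := MeasurableSet.empty.nullMeasurableSet
  measurableSet_compl := fun _ h => h.compl
  measurableSet_iUnion := fun _ h => NullMeasurableSet.iUnion h

/-- The σ-algebra of universally measurable sets: the intersection of the completions
of the ambient (Borel) σ-algebra with respect to all probability measures. -/
def univMS (Y : Type*) [MeasurableSpace Y] : MeasurableSpace Y :=
  ⨅ (μ : Measure Y) (_ : IsProbabilityMeasure μ), completionMS μ

/-- The support of a probability measure: the set of points all of whose open
neighbourhoods have positive measure. -/
def msupp {X : Type*} [TopologicalSpace X] [MeasurableSpace X] (μ : ProbabilityMeasure X) :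
    Set X :=
  {x | ∀ U : Set X, IsOpen U → x ∈ U → 0 < μ.toMeasure U}

/-- `ρ` is a metrization of the topological space `X`: it is a metric and the
neighbourhood filters are generated by its open balls. -/
structure IsMetrization {X : Type*} [TopologicalSpace X] (ρ : X → X → ℝ) : Prop where
  refl : ∀ x, ρ x x = 0
  pos : ∀ x y, x ≠ y → 0 < ρ x y
  symm : ∀ x y, ρ x y = ρ y x
  triangle : ∀ x y z, ρ x z ≤ ρ x y + ρ y z
  nhds_basis : ∀ x : X, (nhds x).HasBasis (fun ε : ℝ => 0 < ε) (fun ε => {y | ρ x y < ε})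

/-- `f` is Lipschitz with respect to the metric `ρ`. -/
def LipWrt {X : Type*} (ρ : X → X → ℝ) (f : X → ℝ) : Prop :=
  ∃ K : ℝ, ∀ x y, |f x - f y| ≤ K * ρ x y

/-- The norm `‖f‖_ρ := max_x |f x| + sup_{x ≠ y} |f x - f y| / ρ x y` on Lipschitz functions. -/
def lipNorm {X : Type*} (ρ : X → X → ℝ) (f : X → ℝ) : ℝ :=
  (⨆ x, |f x|) + sSup {c | ∃ x y, x ≠ y ∧ c = |f x - f y| / ρ x y}

/-- The Kantorovich-Rubinstein distance
`D^ρ(μ, ν) := sup {E_μ[f] - E_ν[f] | f Lipschitz, ‖f‖_ρ ≤ 1}`. -/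
def KRdist {X : Type*} [MeasurableSpace X] (ρ : X → X → ℝ) (μ ν : ProbabilityMeasure X) : ℝ :=
  sSup {c | ∃ f : X → ℝ, LipWrt ρ f ∧ lipNorm ρ f ≤ 1 ∧
    c = (∫ x, f x ∂(μ : Measure X)) - ∫ x, f x ∂(ν : Measure X)}

/-- The Kantorovich-Rubinstein distance from a measure to a set of measures. -/
def KRdistSet {X : Type*} [MeasurableSpace X] (ρ : X → X → ℝ) (μ : ProbabilityMeasure X)
    (A : Set (ProbabilityMeasure X)) : ℝ :=
  sInf {c | ∃ ν ∈ A, c = KRdist ρ μ ν}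

/-- Convexity for a set of probability measures. -/
def ConvexPM {X : Type*} [MeasurableSpace X] (A : Set (ProbabilityMeasure X)) : Prop :=
  ∀ μ ∈ A, ∀ ν ∈ A, ∀ p : ℝ≥0, p ≤ 1 → ∀ ξ : ProbabilityMeasure X,
    (ξ : Measure X) = p • (μ : Measure X) + (1 - p) • (ν : Measure X) → ξ ∈ A

/-- `κ` is a regular conditional probability for `μ` given `π`: it is a measurable family
of probability measures which disintegrates `μ` over `π_* μ` and is concentrated on fibers. -/
def IsRCP {X Y : Type*} [MeasurableSpace X] [MeasurableSpace Y]
    (μ : Measure X) (π : X → Y) (κ : Y → ProbabilityMeasure X) : Prop :=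
  Measurable (fun y => (κ y : Measure X)) ∧
  (∀ s : Set X, MeasurableSet s → ∀ t : Set Y, MeasurableSet t →
    μ (s ∩ π ⁻¹' t) = ∫⁻ y in t, (κ y : Measure X) s ∂(μ.map π)) ∧
  (∀ᵐ y ∂(μ.map π), (κ y : Measure X) (π ⁻¹' {y}) = 1)

/-- `N` is a regular upper bound for `M | π` (Definition 2.2 of the paper). -/
structure IsRUB {X Y : Type*} [TopologicalSpace X] [TopologicalSpace Y]
    [MeasurableSpace X] [MeasurableSpace Y] [OpensMeasurableSpace X]
    (π : X → Y) (M : Set (ProbabilityMeasure X)) (N : Y → Set (ProbabilityMeasure X)) : Prop where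
  closed : IsClosed {p : Y × ProbabilityMeasure X | p.2 ∈ N p.1}
  convex : ∀ y, ConvexPM (N y)
  cond : ∀ μ ∈ M, ∀ κ : Y → ProbabilityMeasure X, IsRCP (μ : Measure X) π κ →
    ∀ᵐ y ∂((μ : Measure X).map π), κ y ∈ N y

/-- `β` is an `(M, r₀)`-savvy bet (with respect to the metric `ρ`). -/
def IsSavvy {X : Type*} [TopologicalSpace X] [MeasurableSpace X] [OpensMeasurableSpace X]
    (ρ : X → X → ℝ) (M : Set (ProbabilityMeasure X)) (r₀ : ℝ)
    (β : ProbabilityMeasure X × X → ℝ) : Prop :=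
  Continuous β ∧
  ∀ μ : ProbabilityMeasure X,
    (∀ x, |β (μ, x)| ≤ max (KRdistSet ρ μ M - r₀) 0) ∧
    ∀ ν ∈ M, (1/2) * (KRdistSet ρ μ M - r₀) * KRdistSet ρ μ M ≤
      (∫ x, β (μ, x) ∂(ν : Measure X)) - ∫ x, β (μ, x) ∂(μ : Measure X)

/-- Borel σ-algebra on the space of probability measures (with its weak topology). -/
instance {X : Type*} [TopologicalSpace X] [MeasurableSpace X] [OpensMeasurableSpace X] :
    MeasurableSpace (ProbabilityMeasure X) := borel _

/-- Borel σ-algebra on a space of continuous functions. -/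
instance {Y : Type*} [TopologicalSpace Y] : MeasurableSpace C(Y, ℝ) := borel _

end
noncomputable section

variable (O : ℕ → Type*) [∀ n, TopologicalSpace (O n)] [∀ n, CompactSpace (O n)]
  [∀ n, PolishSpace (O n)] [∀ n, MeasurableSpace (O n)] [∀ n, BorelSpace (O n)]

/-- The space `O^n` of observation histories of length `n`. -/
abbrev Hn (n : ℕ) : Type _ := ∀ i : Fin n, O i

/-- The space `O^ω` of infinite observation sequences. -/
abbrev Hw : Type _ := ∀ n : ℕ, O n

/-- The projection `O^ω → O^n`, `x ↦ x_{:n}`. -/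
def proj (n : ℕ) : Hw O → Hn O n := fun x i => x i

/-- The cylinder `yO^ω` over `y ∈ O^n`. -/
def cyl (n : ℕ) (y : Hn O n) : Set (Hw O) := {x | proj O n x = y}

/-- Truncation `O^n → O^m` for `m ≤ n`. -/
def trunc {m n : ℕ} (h : m ≤ n) (y : Hn O n) : Hn O m := fun i => y (i.castLE h)

/-- The payoff `(Vβ)(μ, x) := β(μ, x) - E_{x' ∼ μ}[β(μ, x')]` of a bet `β`. -/
def Vbet {X : Type*} [MeasurableSpace X]
    (β : ProbabilityMeasure X × X → ℝ) (μ : ProbabilityMeasure X) (x : X) : ℝ :=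
  β (μ, x) - ∫ x', β (μ, x') ∂(μ : Measure X)

/-- The sup norm of a bet. -/
def gmNorm {X : Type*} [MeasurableSpace X] (β : ProbabilityMeasure X × X → ℝ) : ℝ :=
  ⨆ p, |β p|

/-- A forecaster: a family of measurable maps `F_n : O^n → P(O^ω)` (with `O^n` carrying the
σ-algebra of universally measurable sets), whose forecasts are supported on the observed
cylinder. -/
structure Forecaster where
  F : ∀ n, Hn O n → ProbabilityMeasure (Hw O)
  measurable : ∀ n, @Measurable _ _ (univMS (Hn O n)) inferInstance (F n)
  supp : ∀ n y, msupp (F n y) ⊆ cyl O n y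

/-- The (not necessarily continuous or measurable) data of a gambler: for each `n`, a map
assigning to an observation history and a forecast history a bet. -/
abbrev PreGambler : Type _ := ∀ n : ℕ, Hn O n × (Fin n → ProbabilityMeasure (Hw O)) →
  ProbabilityMeasure (Hw O) × Hw O → ℝ

/-- A gambler: a family of measurable maps `G_n : O^n × P(O^ω)^n → Gm(O^ω)`, where `O^n`
carries the universally measurable σ-algebra, `P(O^ω)^n` the Borel σ-algebra, and the space
`Gm(O^ω) = C(P(O^ω) × O^ω)` of bets the Borel σ-algebra. -/
structure Gambler where
  G : ∀ n : ℕ, Hn O n × (Fin n → ProbabilityMeasure (Hw O)) →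
    C(ProbabilityMeasure (Hw O) × Hw O, ℝ)
  measurable : ∀ n, @Measurable _ _ (MeasurableSpace.prod (univMS (Hn O n)) inferInstance)
    inferInstance (G n)

/-- The underlying bet-valued data of a gambler. -/
def Gambler.pre (G : Gambler O) : PreGambler O := fun n yμ p => G.G n yμ p

/-- The forecast history of a forecaster along an observation history. -/
def fhist (F : ∀ n, Hn O n → ProbabilityMeasure (Hw O)) (n : ℕ) (y : Hn O n) :
    Fin n → ProbabilityMeasure (Hw O) := fun m => F m (trunc O m.isLt.le y)

/-- The total payoff `SV G_n(y, μ̄)(x)` of the first `n` gambles of a gambler `G`,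
given forecasts `μ̄` (here `y ∈ O^{n-1}`). -/
def SVg (G : PreGambler O) (n : ℕ) (y : Hn O (n-1))
    (μs : Fin n → ProbabilityMeasure (Hw O)) (x : Hw O) : ℝ :=
  ∑ m : Fin n, Vbet (G m (trunc O (Nat.le_pred_of_lt m.isLt) y,
      fun i : Fin m => μs (i.castLE m.isLt.le)))
    (μs m) x

/-- The minimal total payoff `SVmin G_n(y, μ̄)` over the cylinder `yO^ω`. -/
def SVgMin (G : PreGambler O) (n : ℕ) (y : Hn O (n-1))
    (μs : Fin n → ProbabilityMeasure (Hw O)) : ℝ :=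
  sInf (SVg O G n y μs '' cyl O (n-1) y)

/-- The maximal total payoff `SVmax G_n(y, μ̄)` over the cylinder `yO^ω`. -/
def SVgMax (G : PreGambler O) (n : ℕ) (y : Hn O (n-1))
    (μs : Fin n → ProbabilityMeasure (Hw O)) : ℝ :=
  sSup (SVg O G n y μs '' cyl O (n-1) y)

/-- The total payoff `SV G^F_n(x)` of the first `n` gambles of a gambler `G` playing
against a forecaster `F`, along the observation sequence `x`. -/
def SVf (G : PreGambler O) (F : ∀ n, Hn O n → ProbabilityMeasure (Hw O)) (n : ℕ)
    (x : Hw O) : ℝ :=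
  ∑ m : Fin n, Vbet (G m (proj O m x, fhist O F m (proj O m x))) (F m (proj O m x)) x

/-- The minimal total payoff `SVmin G^F_n(y)` over the cylinder `yO^ω`, `y ∈ O^{n-1}`. -/
def SVfMin (G : PreGambler O) (F : ∀ n, Hn O n → ProbabilityMeasure (Hw O)) (n : ℕ)
    (y : Hn O (n-1)) : ℝ :=
  sInf (SVf O G F n '' cyl O (n-1) y)

/-- The maximal total payoff `SVmax G^F_n(y)` over the cylinder `yO^ω`, `y ∈ O^{n-1}`. -/
def SVfMax (G : PreGambler O) (F : ∀ n, Hn O n → ProbabilityMeasure (Hw O)) (n : ℕ)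
    (y : Hn O (n-1)) : ℝ :=
  sSup (SVf O G F n '' cyl O (n-1) y)

/-- A forecaster (given by its family of forecasts) dominates a gambler when, along every
observation sequence, if the gambler's minimal total payoff is bounded below then its
maximal total payoff is bounded above. -/
def Dominates (F : ∀ n, Hn O n → ProbabilityMeasure (Hw O)) (G : PreGambler O) : Prop :=
  ∀ x : Hw O,
    BddBelow (Set.range fun n => SVfMin O G F n (proj O (n-1) x)) →
    BddAbove (Set.range fun n => SVfMax O G F n (proj O (n-1) x))

/-- A gambling strategy: a uniformly bounded family of measurable maps `S_n : O^n → Gm(O^ω)`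
(not depending on the forecast history). -/
structure Strategy where
  S : ∀ n : ℕ, Hn O n → C(ProbabilityMeasure (Hw O) × Hw O, ℝ)
  measurable : ∀ n, @Measurable _ _ (univMS (Hn O n)) inferInstance (S n)
  bounded : ∃ C : ℝ, ∀ n y p, |S n y p| ≤ C

open scoped Classical in
/-- The gambler `PG S` associated to a gambling strategy `S`: it plays `S` in round `n`
exactly when the uncertainty about the total payoff of previous bets is at most `1`. -/
def PGfun (S : Strategy O) : (n : ℕ) → Hn O n × (Fin n → ProbabilityMeasure (Hw O)) →
    C(ProbabilityMeasure (Hw O) × Hw O, ℝ)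
  | n, yμ =>
    let sv : Hw O → ℝ := fun x =>
      ∑ m : Fin n, Vbet (fun p => PGfun S m
          (trunc O m.isLt.le yμ.1, fun i : Fin m => yμ.2 (i.castLE m.isLt.le)) p)
        (yμ.2 m) x
    if sSup (sv '' cyl O (n-1) (trunc O (Nat.sub_le n 1) yμ.1)) -
        sInf (sv '' cyl O (n-1) (trunc O (Nat.sub_le n 1) yμ.1)) ≤ 1
    then S.S n yμ.1 else 0
termination_by n => n
decreasing_by exact m.isLt

/-- The gambler `PG S`, as gambling data. -/
def PGpre (S : Strategy O) : PreGambler O := fun n yμ p => PGfun O S n yμ p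

/-- The normalization factor `Nr_b G_n(y, μ̄; ν)` used to enforce a finite budget `b`. -/
def NrFun (G : PreGambler O) (b : ℝ) (n : ℕ) (y : Hn O n)
    (μs : Fin n → ProbabilityMeasure (Hw O)) (ν : ProbabilityMeasure (Hw O)) : ℝ :=
  (max 1 (sSup ((fun x => (-(Vbet (G n (y, μs)) ν x)) /
      (SVg O G n (trunc O (Nat.sub_le n 1) y) μs x + b)) '' cyl O n y)))⁻¹

open scoped Classical in
/-- The gambler `Bd_b G`: the modification of `G` which never loses more than the budget
`b`. -/
def BdG (G : PreGambler O) (b : ℝ) : PreGambler O := fun n yμ =>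
  if ∀ m : Fin n, -b < SVgMin O G (m.1+1) (trunc O m.isLt.le yμ.1)
      (fun i : Fin (m.1+1) => yμ.2 (i.castLE m.isLt)) then
    fun p => NrFun O G b n yμ.1 yμ.2 p.1 * G n yμ p
  else fun _ => 0

/-- A gambling strategy `S` is `μ*`-prudent when, for some `α > 0`, for every round, almost
every observation history and every forecast, the expected payoff of the bet under the true
environment `μ*` exceeds the payoff under the forecast by at least `α` times the spread of
the bet. -/
def IsPrudent (S : Strategy O) (μstar : ProbabilityMeasure (Hw O)) : Prop :=
  ∃ α : ℝ, 0 < α ∧ ∀ n : ℕ, ∀ κ : Hn O n → ProbabilityMeasure (Hw O),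
    IsRCP (μstar : Measure (Hw O)) (proj O n) κ →
      ∀ᵐ y ∂((μstar : Measure (Hw O)).map (proj O n)), ∀ μ : ProbabilityMeasure (Hw O),
        α * (sSup ((fun x => S.S n y (μ, x)) '' cyl O n y) -
             sInf ((fun x => S.S n y (μ, x)) '' cyl O n y)) ≤
          (∫ x, S.S n y (μ, x) ∂(κ y : Measure (Hw O))) -
            ∫ x, S.S n y (μ, x) ∂(μ : Measure (Hw O))

omit [∀ n, CompactSpace (O n)] in
open scoped Classical in
/-- The recursion defining `PG S`, in terms of the extremal total payoffs of `PG S` itself. -/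
lemma PGfun_eq (S : Strategy O) (n : ℕ) (y : Hn O n)
    (μs : Fin n → ProbabilityMeasure (Hw O)) :
    PGfun O S n (y, μs) =
      if SVgMax O (PGpre O S) n (trunc O (Nat.sub_le n 1) y) μs -
        SVgMin O (PGpre O S) n (trunc O (Nat.sub_le n 1) y) μs ≤ 1
      then S.S n y else 0 := by
  rw [PGfun]
  rfl

omit [∀ n, TopologicalSpace (O n)] [∀ n, CompactSpace (O n)] [∀ n, PolishSpace (O n)]
  [∀ n, BorelSpace (O n)] in
lemma SVg_succ (G : PreGambler O) (n : ℕ) (y : Hn O n)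
    (μs : Fin (n + 1) → ProbabilityMeasure (Hw O)) (x : Hw O) :
    SVg O G (n + 1) y μs x =
      SVg O G n (trunc O (Nat.sub_le n 1) y) (fun i => μs i.castSucc) x +
        Vbet (G n (y, fun i => μs i.castSucc)) (μs (Fin.last n)) x := by
  unfold SVg
  rw [Fin.sum_univ_castSucc]
  rfl

lemma abs_Vbet_le {X : Type*} [MeasurableSpace X] {β : ProbabilityMeasure X × X → ℝ} {C : ℝ}
    (hβ : ∀ p, |β p| ≤ C) (μ : ProbabilityMeasure X) (x : X) : |Vbet β μ x| ≤ 2 * C := by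
  have hint : |∫ x', β (μ, x') ∂(μ : Measure X)| ≤ C := by
    simpa using norm_integral_le_of_norm_le_const (μ := (μ : Measure X))
      (f := fun x' => β (μ, x')) (.of_forall fun x' => hβ (μ, x'))
  calc |Vbet β μ x| ≤ |β (μ, x)| + |∫ x', β (μ, x') ∂(μ : Measure X)| := abs_sub _ _
    _ ≤ 2 * C := by linarith [hβ (μ, x)]

lemma Vbet_sub_le {X : Type*} [MeasurableSpace X] {β : ProbabilityMeasure X × X → ℝ} {C : ℝ}
    (hβ : ∀ p, |β p| ≤ C) (μ : ProbabilityMeasure X) (x x' : X) :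
    Vbet β μ x - Vbet β μ x' ≤ 2 * C := by
  unfold Vbet
  linarith [(abs_le.1 (hβ (μ, x))).2, (abs_le.1 (hβ (μ, x'))).1]

omit [∀ n, CompactSpace (O n)] in
lemma abs_PGfun_le (S : Strategy O) (n : ℕ) (yμ : Hn O n × (Fin n → ProbabilityMeasure (Hw O)))
    {C : ℝ} (hS : ∀ y p, |S.S n y p| ≤ C) (p : ProbabilityMeasure (Hw O) × Hw O) :
    |PGfun O S n yμ p| ≤ C := by
  rw [← Prod.mk.eta (p := yμ), PGfun_eq]
  split_ifs
  · exact hS _ _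
  · simpa using (abs_nonneg _).trans (hS yμ.1 p)

omit [∀ n, TopologicalSpace (O n)] [∀ n, CompactSpace (O n)] [∀ n, PolishSpace (O n)]
  [∀ n, BorelSpace (O n)] in
lemma abs_SVg_le {G : PreGambler O} {C : ℝ} (hG : ∀ n yμ p, |G n yμ p| ≤ C) (n : ℕ)
    (y : Hn O (n - 1)) (μs : Fin n → ProbabilityMeasure (Hw O)) (x : Hw O) :
    |SVg O G n y μs x| ≤ n * (2 * C) := by
  refine (Finset.abs_sum_le_sum_abs _ _).trans ?_
  refine (Finset.sum_le_sum fun m _ => abs_Vbet_le (hG _ _) _ _).trans ?_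
  simp

omit [∀ n, TopologicalSpace (O n)] [∀ n, CompactSpace (O n)] [∀ n, PolishSpace (O n)]
  [∀ n, BorelSpace (O n)] in
lemma SVg_sub_le_SVgMax_sub_SVgMin {G : PreGambler O} {C : ℝ} (hG : ∀ n yμ p, |G n yμ p| ≤ C)
    (n : ℕ) (y : Hn O (n - 1)) (μs : Fin n → ProbabilityMeasure (Hw O)) {x x' : Hw O}
    (hx : x ∈ cyl O (n - 1) y) (hx' : x' ∈ cyl O (n - 1) y) :
    SVg O G n y μs x - SVg O G n y μs x' ≤ SVgMax O G n y μs - SVgMin O G n y μs := by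
  have habs := abs_SVg_le O hG n y μs
  refine sub_le_sub (le_csSup ⟨n * (2 * C), ?_⟩ (mem_image_of_mem _ hx))
    (csInf_le ⟨-(n * (2 * C)), ?_⟩ (mem_image_of_mem _ hx'))
  · rintro _ ⟨z, -, rfl⟩
    exact (abs_le.1 (habs z)).2
  · rintro _ ⟨z, -, rfl⟩
    exact (abs_le.1 (habs z)).1

omit [∀ n, TopologicalSpace (O n)] [∀ n, CompactSpace (O n)] [∀ n, PolishSpace (O n)]
  [∀ n, MeasurableSpace (O n)] [∀ n, BorelSpace (O n)] in
lemma cyl_subset_cyl_trunc {m n : ℕ} (h : m ≤ n) (y : Hn O n) :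
    cyl O n y ⊆ cyl O m (trunc O h y) := by
  rintro x rfl
  rfl

omit [∀ n, CompactSpace (O n)] in
lemma SVg_PGpre_sub_le (S : Strategy O) {C : ℝ} (hC : 0 ≤ C) (n : ℕ)
    (hS : ∀ m < n, ∀ y p, |S.S m y p| ≤ C) (y : Hn O (n - 1))
    (μs : Fin n → ProbabilityMeasure (Hw O)) {x x' : Hw O}
    (hx : x ∈ cyl O (n - 1) y) (hx' : x' ∈ cyl O (n - 1) y) :
    SVg O (PGpre O S) n y μs x - SVg O (PGpre O S) n y μs x' ≤ 2 * C + 1 := by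
  induction n with
  | zero =>
    simp only [SVg, Finset.univ_eq_empty, Finset.sum_empty]
    linarith
  | succ n ih =>
    have hsub := cyl_subset_cyl_trunc O (Nat.sub_le n 1) y
    obtain ⟨B, hB⟩ := S.bounded
    rw [SVg_succ, SVg_succ]
    by_cases h : SVgMax O (PGpre O S) n (trunc O (Nat.sub_le n 1) y) (fun i => μs i.castSucc) -
        SVgMin O (PGpre O S) n (trunc O (Nat.sub_le n 1) y) (fun i => μs i.castSucc) ≤ 1
    · have hprev := SVg_sub_le_SVgMax_sub_SVgMin O (G := PGpre O S)
        (fun m yμ => abs_PGfun_le O S m yμ (hB m)) n (trunc O (Nat.sub_le n 1) y)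
        (fun i => μs i.castSucc) (hsub hx) (hsub hx')
      have hlast := Vbet_sub_le (β := PGpre O S n (y, fun i => μs i.castSucc))
        (abs_PGfun_le O S n _ (hS n n.lt_succ_self)) (μs (Fin.last n)) x x'
      linarith
    · have hzero : PGpre O S n (y, fun i => μs i.castSucc) = fun _ => 0 := by
        funext p
        simp [PGpre, PGfun_eq, h]
      have hprev := ih (fun m hm => hS m (hm.trans n.lt_succ_self))
        (trunc O (Nat.sub_le n 1) y) (fun i => μs i.castSucc) (hsub hx) (hsub hx')
      simpa [hzero, Vbet] using hprev

/-- Proposition 4.1 of the paper: at any moment, the uncertainty of the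
gambler `PG S` about the total worth of its bets is bounded by twice the norm of the
strategy's bets so far, plus one. -/
theorem statement10 (S : Strategy O) (n : ℕ) (y : Hn O (n-1))
    (μs : Fin n → ProbabilityMeasure (Hw O)) (x : Hw O) (hx : x ∈ cyl O (n-1) y) :
    SVg O (PGpre O S) n y μs x - SVgMin O (PGpre O S) n y μs ≤
      2 * sSup {c : ℝ | ∃ m : Fin n, ∃ y' : Hn O m, c = gmNorm (fun p => S.S m y' p)} + 1 := by
  obtain ⟨B, hB⟩ := S.bounded
  set A := {c : ℝ | ∃ m : Fin n, ∃ y' : Hn O m, c = gmNorm (fun p => S.S m y' p)} with hA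
  have hA_bdd : BddAbove A := by
    refine ⟨B, ?_⟩
    rintro _ ⟨m, y', rfl⟩
    exact Real.iSup_le (hB m y') ((abs_nonneg _).trans (hB m y' (⟨.dirac x, inferInstance⟩, x)))
  have hA_nonneg : 0 ≤ sSup A := by
    refine Real.sSup_nonneg ?_
    rintro _ ⟨m, y', rfl⟩
    exact Real.iSup_nonneg fun p => abs_nonneg _
  have hS : ∀ m < n, ∀ y' p, |S.S m y' p| ≤ sSup A := fun m hm y' p =>
    (le_ciSup (f := fun p => |S.S m y' p|) ⟨B, forall_mem_range.2 (hB m y')⟩ p).trans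
      (le_csSup hA_bdd ⟨⟨m, hm⟩, y', rfl⟩)
  rw [sub_le_comm]
  refine le_csInf ⟨_, mem_image_of_mem _ hx⟩ ?_
  rintro _ ⟨x', hx', rfl⟩
  rw [sub_le_comm]
  exact SVg_PGpre_sub_le O S hA_nonneg n hS y μs hx hx'

end
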